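/- For 8 points l_1,...,l_8 in generic position in P³(F), one has in B_2(F) ⊗ Λ²F*: Alt_8( ( 2·(l_3,l_4|l_1,l_2,l_6,l_7)_2 + 2·(l_3,l_6|l_1,l_2,l_5,l_7)_2 + 2·(l_4,l_6|l_1,l_2,l_3,l_7)_2 + 2·(l_4,l_6|l_1,l_2,l_5,l_7)_2 + (l_5,l_4|l_1,l_2,l_6,l_7)_2 ) ⊗ Δ(l_1,l_2,l_3,l_4) ∧ Δ(l_1,l_2,l_3,l_5) ) = 7 · Alt_8( (l_3,l_4|l_1,l_2,l_6,l_7)_2 ⊗ Δ(l_1,l_2,l_3,l_4) ∧ Δ(l_1,l_2,l_3,l_5) ). -/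

import Mathlib

noncomputable section
open scoped TensorProduct
open Classical

namespace Gon

variable (F : Type) [Field F]

/-- Points of the projective space `P^{d-1}(F)`, i.e. lines in `F^d`. -/
abbrev Pt (d : ℕ) := Projectivization F (Fin d → F)

variable {F}

/-- Determinant of a `d`-tuple of vectors in `F^d` (w.r.t. the standard volume form). -/
def dt {d : ℕ} (v : Fin d → (Fin d → F)) : F := Matrix.det (Matrix.of v)

/-- `Δ` of three vectors of `F^3`. -/
def det3 (a b c : Fin 3 → F) : F := dt ![a, b, c]

/-- `Δ` of four vectors of `F^4`. -/
def det4 (a b c d : Fin 4 → F) : F := dt ![a, b, c, d]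

/-- Cross-ratio of four points on the projective line. -/
def cr1 (a b c d : Pt F 2) : F :=
  (dt ![a.rep, c.rep] * dt ![b.rep, d.rep]) / (dt ![a.rep, d.rep] * dt ![b.rep, c.rep])

/-- Cross-ratio of the four points of `P^1` obtained by projecting `a b c d` from the
centre `e` in the projective plane. -/
def crFrom3 (e a b c d : Pt F 3) : F :=
  (det3 e.rep a.rep c.rep * det3 e.rep b.rep d.rep) /
    (det3 e.rep a.rep d.rep * det3 e.rep b.rep c.rep)

/-- Cross-ratio of the four points of `P^1` obtained by projecting `a b c d` from the
line through `p` and `q` in `P^3`. -/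
def crLine (p q a b c d : Pt F 4) : F :=
  (det4 p.rep q.rep a.rep c.rep * det4 p.rep q.rep b.rep d.rep) /
    (det4 p.rep q.rep a.rep d.rep * det4 p.rep q.rep b.rep c.rep)

variable (F)

/-- `ℚ[F]`, the free `ℚ`-vector space on the set `F`. -/
abbrev QF := F →₀ ℚ

variable {F}

/-- The generator `{x}` of `ℚ[F]`, with the convention `{0} = {∞} = 0`. -/
def gen (a : F) : QF F := if a = 0 then 0 else Finsupp.single a 1

/-- The five term element of `ℚ[F]` attached to five points of the projective line. -/
def fiveTerm (x : Fin 5 → Pt F 2) : QF F :=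
  ∑ i : Fin 5, ((-1 : ℤ) ^ (i : ℕ)) •
    gen (cr1 (x (i.succAbove 0)) (x (i.succAbove 1)) (x (i.succAbove 2)) (x (i.succAbove 3)))

variable (F)

/-- `R_2(F)`: the five-term relations for five distinct points of `P^1(F)`, together with
`{1}` (the generators of `ℤ[F^* ∖ {1}]` omit `1`). -/
def R2 : Submodule ℚ (QF F) :=
  Submodule.span ℚ
    ({z | ∃ x : Fin 5 → Pt F 2, Function.Injective x ∧ z = fiveTerm x} ∪ {gen (1 : F)})

/-- The Bloch group `B_2(F)` (tensored with `ℚ`). -/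
abbrev B2 := QF F ⧸ R2 F

def clsB2 : QF F →ₗ[ℚ] B2 F := (R2 F).mkQ

/-- `{x}_2 ∈ B_2(F)`. -/
def b2 (a : F) : B2 F := clsB2 F (gen a)

variable {F}

variable (F)

/-- `F^* ⊗ ℚ`, presented as the free `ℚ`-vector space on `F` modulo multiplicativity
(and modulo the generator at `0`). -/
def FSrel : Set (QF F) :=
  {z | ∃ x y : F, x ≠ 0 ∧ y ≠ 0 ∧
      z = Finsupp.single (x * y) 1 - Finsupp.single x 1 - Finsupp.single y 1} ∪
    {Finsupp.single (0 : F) 1}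

abbrev FS := QF F ⧸ Submodule.span ℚ (FSrel F)

/-- The class of `x ∈ F` in `F^* ⊗ ℚ`. -/
def fs (a : F) : FS F := (Submodule.span ℚ (FSrel F)).mkQ (Finsupp.single a 1)

variable {F}

variable (F)

/-- The exterior algebra of `F^* ⊗ ℚ`, housing `Λ² F^*`. -/
abbrev LamFS := ExteriorAlgebra ℚ (FS F)

/-- `B_2(F) ⊗ Λ² F^*` (inside `B_2(F) ⊗ Λ^•(F^* ⊗ ℚ)`). -/
abbrev T22 := B2 F ⊗[ℚ] LamFS F

variable {F}

/-- wedge product. -/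
def wedge {M : Type} [AddCommGroup M] [Module ℚ M] (a b : M) : ExteriorAlgebra ℚ M :=
  ExteriorAlgebra.ι ℚ a * ExteriorAlgebra.ι ℚ b

/-- Eight points of `P^3` are in generic position when any four of them are projectively
independent. -/
def Generic8 (x : Fin 8 → Pt F 4) : Prop :=
  ∀ a b c d : Fin 8, a ≠ b → a ≠ c → a ≠ d → b ≠ c → b ≠ d → c ≠ d →
    det4 (x a).rep (x b).rep (x c).rep (x d).rep ≠ 0

lemma dt_two (u v : Fin 2 → F) : dt ![u, v] = u 0 * v 1 - u 1 * v 0 := by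
  simp [dt, Matrix.det_fin_two]

lemma det4_expand (a b c d : Fin 4 → F) :
    det4 a b c d =
      (a 0 * b 1 - a 1 * b 0) * (c 2 * d 3 - c 3 * d 2)
      - (a 0 * b 2 - a 2 * b 0) * (c 1 * d 3 - c 3 * d 1)
      + (a 0 * b 3 - a 3 * b 0) * (c 1 * d 2 - c 2 * d 1)
      + (a 1 * b 2 - a 2 * b 1) * (c 0 * d 3 - c 3 * d 0)
      - (a 1 * b 3 - a 3 * b 1) * (c 0 * d 2 - c 2 * d 0)
      + (a 2 * b 3 - a 3 * b 2) * (c 0 * d 1 - c 1 * d 0) := by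
  have h0 : (Fin.succAbove (1 : Fin 4) (2 : Fin 3)) = 3 := rfl
  have h1 : (Fin.succAbove (2 : Fin 4) (2 : Fin 3)) = 3 := rfl
  have h2 : (Fin.succAbove (3 : Fin 4) (2 : Fin 3)) = 2 := rfl
  simp [det4, dt, Matrix.det_succ_row_zero (n := 3), Matrix.det_fin_three, Fin.sum_univ_succ,
    h0, h1, h2]
  ring

lemma det4_swap_first (a b c d : Fin 4 → F) : det4 b a c d = -det4 a b c d := by
  rw [det4_expand, det4_expand]; ring

lemma det4_swap_mid (a b c d : Fin 4 → F) : det4 a c b d = -det4 a b c d := by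
  rw [det4_expand, det4_expand]; ring

lemma det4_swap_last (a b c d : Fin 4 → F) : det4 a b d c = -det4 a b c d := by
  rw [det4_expand, det4_expand]; ring

/-- The three-term Plücker relation. -/
lemma det4_plucker (p q i j k l : Fin 4 → F) :
    det4 p q i k * det4 p q j l - det4 p q i l * det4 p q j k =
      det4 p q i j * det4 p q k l := by
  simp only [det4_expand]; ring

/-- The five-term relation, in terms of numbers proportional to the brackets of five vectors. -/
lemma fiveTerm_brackets (y : Fin 5 → Fin 2 → F) (m : Fin 5 → Fin 5 → F) (k : F) (hk : k ≠ 0)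
    (h : ∀ i j, i < j → dt ![y i, y j] = k * m i j) (hm : ∀ i j, i < j → m i j ≠ 0) :
    b2 F (m 1 3 * m 2 4 / (m 1 4 * m 2 3)) - b2 F (m 0 3 * m 2 4 / (m 0 4 * m 2 3))
      + b2 F (m 0 3 * m 1 4 / (m 0 4 * m 1 3)) - b2 F (m 0 2 * m 1 4 / (m 0 4 * m 1 2))
      + b2 F (m 0 2 * m 1 3 / (m 0 3 * m 1 2)) = 0 := by
  have hdt : ∀ i j, i < j → dt ![y i, y j] ≠ 0 := fun i j hij ↦ by
    rw [h i j hij]; exact mul_ne_zero hk (hm i j hij)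
  have hy : ∀ i, y i ≠ 0 := by
    intro i hi
    rcases lt_or_ge i 4 with h4 | h4
    · exact hdt i 4 h4 (by rw [dt_two, hi]; simp)
    · exact hdt 0 i (lt_of_lt_of_le (by decide) h4) (by rw [dt_two, hi]; simp)
  let x : Fin 5 → Pt F 2 := fun i ↦ Projectivization.mk F (y i) (hy i)
  have hrep : ∀ i, ∃ a : F, a ≠ 0 ∧ (x i).rep = a • y i := by
    intro i
    obtain ⟨a, ha⟩ := Projectivization.exists_smul_eq_mk_rep F (y i) (hy i)
    exact ⟨a, a.ne_zero, ha.symm⟩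
  choose a ha hxa using hrep
  have hxdt : ∀ i j, i < j → dt ![(x i).rep, (x j).rep] = a i * a j * k * m i j := by
    intro i j hij
    have := h i j hij
    rw [dt_two] at this
    rw [dt_two, hxa, hxa]
    simp only [Pi.smul_apply, smul_eq_mul]
    linear_combination a i * a j * this
  have hxne : ∀ i j, i < j → x i ≠ x j := by
    intro i j hij he
    have h1 := hxdt i j hij
    rw [he, dt_two] at h1
    have h2 : a i * a j * k * m i j ≠ 0 :=
      mul_ne_zero (mul_ne_zero (mul_ne_zero (ha i) (ha j)) hk) (hm i j hij)
    exact h2 (by rw [← h1]; ring)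
  have hinj : Function.Injective x := by
    intro i j hij
    rcases lt_trichotomy i j with hlt | heq | hgt
    · exact absurd hij (hxne i j hlt)
    · exact heq
    · exact absurd hij.symm (hxne j i hgt)
  have hcr : ∀ i j l n, i < j → j < l → l < n →
      cr1 (x i) (x j) (x l) (x n) = m i l * m j n / (m i n * m j l) := by
    intro i j l n hij hjl hln
    have hjn := hjl.trans hln
    have hil := hij.trans hjl
    have hin := hij.trans hjn
    have := hm i n hin
    have := hm j l hjl
    have := ha i
    have := ha j
    have := ha l
    have := ha n
    rw [cr1, hxdt i l hil, hxdt j n hjn, hxdt i n hin, hxdt j l hjl]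
    field_simp
  have hz : clsB2 F (fiveTerm x) = 0 := by
    rw [clsB2, Submodule.mkQ_apply, Submodule.Quotient.mk_eq_zero]
    exact Submodule.subset_span (Or.inl ⟨x, hinj, rfl⟩)
  have e : fiveTerm x =
      gen (cr1 (x 1) (x 2) (x 3) (x 4)) - gen (cr1 (x 0) (x 2) (x 3) (x 4))
        + gen (cr1 (x 0) (x 1) (x 3) (x 4)) - gen (cr1 (x 0) (x 1) (x 2) (x 4))
        + gen (cr1 (x 0) (x 1) (x 2) (x 3)) := by
    rw [fiveTerm, Fin.sum_univ_five]
    change ((-1 : ℤ) ^ 0) • gen (cr1 (x 1) (x 2) (x 3) (x 4))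
      + ((-1 : ℤ) ^ 1) • gen (cr1 (x 0) (x 2) (x 3) (x 4))
      + ((-1 : ℤ) ^ 2) • gen (cr1 (x 0) (x 1) (x 3) (x 4))
      + ((-1 : ℤ) ^ 3) • gen (cr1 (x 0) (x 1) (x 2) (x 4))
      + ((-1 : ℤ) ^ 4) • gen (cr1 (x 0) (x 1) (x 2) (x 3)) = _
    module
  rw [e, hcr 1 2 3 4 (by decide) (by decide) (by decide),
    hcr 0 2 3 4 (by decide) (by decide) (by decide),
    hcr 0 1 3 4 (by decide) (by decide) (by decide),
    hcr 0 1 2 4 (by decide) (by decide) (by decide),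
    hcr 0 1 2 3 (by decide) (by decide) (by decide)] at hz
  simpa only [map_add, map_sub, b2] using hz

/-- The class `(z_p, z_q | z_a, z_b, z_c, z_d)_2` of a projected cross-ratio. -/
def crB2 (z : Fin 8 → Pt F 4) (p q a b c d : Fin 8) : B2 F :=
  b2 F (crLine (z p) (z q) (z a) (z b) (z c) (z d))

lemma crB2_comm (z : Fin 8 → Pt F 4) (p q a b c d : Fin 8) :
    crB2 z q p a b c d = crB2 z p q a b c d := by
  simp only [crB2, crLine, det4_swap_first (z p).rep (z q).rep, neg_mul_neg]

lemma crB2_klein (z : Fin 8 → Pt F 4) (p q a b c d : Fin 8) :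
    crB2 z p q b a d c = crB2 z p q a b c d := by
  simp only [crB2, crLine]
  congr 1
  rw [mul_comm (det4 _ _ (z b).rep (z d).rep), mul_comm (det4 _ _ (z b).rep (z c).rep)]

/-- The five-term relation for the projection of five points from a line. -/
lemma crB2_line {z : Fin 8 → Pt F 4} (hz : Generic8 z) {p q a b c d e : Fin 8}
    (h : [p, q, a, b, c, d, e].Nodup) :
    crB2 z p q b c d e - crB2 z p q a c d e + crB2 z p q a b d e - crB2 z p q a b c e
      + crB2 z p q a b c d = 0 := by
  let v : Fin 5 → Fin 8 := ![a, b, c, d, e]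
  have hv : ∀ i j, i < j → det4 (z p).rep (z q).rep (z (v i)).rep (z (v j)).rep ≠ 0 := by
    simp only [List.nodup_cons, List.mem_cons, List.not_mem_nil, or_false, not_or] at h
    intro i j hij
    fin_cases i <;> fin_cases j <;> first
      | exact absurd hij (by decide)
      | (apply hz <;> simp [v] <;> tauto)
  exact fiveTerm_brackets
    (fun i ↦ ![det4 (z p).rep (z q).rep (z (v i)).rep (z a).rep,
      det4 (z p).rep (z q).rep (z (v i)).rep (z b).rep])
    (fun i j ↦ det4 (z p).rep (z q).rep (z (v i)).rep (z (v j)).rep)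
    (det4 (z p).rep (z q).rep (z a).rep (z b).rep) (hv 0 1 (by decide))
    (fun i j _ ↦ by
      rw [dt_two]
      simpa [mul_comm] using
        det4_plucker (z p).rep (z q).rep (z (v i)).rep (z (v j)).rep (z a).rep (z b).rep) hv

lemma crB2_swap_first_aux {z : Fin 8 → Pt F 4} (hz : Generic8 z) {p q a b c d e : Fin 8}
    (h : [p, q, a, b, c, d, e].Nodup) :
    crB2 z p q b a c d = -crB2 z p q a b c d := by
  have h1 := crB2_line hz h
  have h2 := crB2_line hz (p := p) (q := q) (a := b) (b := a) (c := c) (d := d) (e := e) (by grind)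
  have h3 := crB2_line hz (p := p) (q := q) (a := a) (b := b) (c := d) (d := c) (e := e) (by grind)
  have h4 := crB2_line hz (p := p) (q := q) (a := b) (b := a) (c := d) (d := c) (e := e) (by grind)
  have k1 := crB2_klein z p q a b c d
  have k2 := crB2_klein z p q b a c d
  have : (2 : ℚ) • (crB2 z p q b a c d + crB2 z p q a b c d) = 0 := by
    linear_combination (norm := module) h1 + h2 + h3 + h4 - k1 - k2
  rw [smul_eq_zero_iff_right (by norm_num)] at this
  exact eq_neg_of_add_eq_zero_left this

lemma exists_nodup_extension {p q a b c d : Fin 8}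
    (h : [p, q, a, b, c, d].Nodup) :
    ∃ e, [p, q, a, b, c, d, e].Nodup := by
  obtain ⟨e, he⟩ : ∃ e : Fin 8, e ∉ ({p, q, a, b, c, d} : Finset (Fin 8)) := by
    by_contra! hall
    have h1 : (Finset.univ : Finset (Fin 8)) ⊆ {p, q, a, b, c, d} := fun i _ ↦ hall i
    have h2 := (Finset.card_le_card h1).trans Finset.card_le_six
    simp at h2
  exact ⟨e, by grind⟩

lemma crB2_swap_first {z : Fin 8 → Pt F 4} (hz : Generic8 z) {p q a b c d : Fin 8}
    (h : [p, q, a, b, c, d].Nodup) :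
    crB2 z p q b a c d = -crB2 z p q a b c d :=
  let ⟨_, he⟩ := exists_nodup_extension h
  crB2_swap_first_aux hz he

/-- The five-term relation for the projections from the lines joining `z_p` to five points,
which comes from the Gale dual of the projection of the five points from `z_p`. -/
lemma crB2_dual {z : Fin 8 → Pt F 4} (hz : Generic8 z) {p a b c d e : Fin 8}
    (h : [p, a, b, c, d, e].Nodup) :
    crB2 z p a b c d e - crB2 z p b a c d e + crB2 z p c a b d e - crB2 z p d a b c e
      + crB2 z p e a b c d = 0 := by
  let D : Fin 8 → Fin 8 → Fin 8 → F := fun i j k ↦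
    det4 (z p).rep (z i).rep (z j).rep (z k).rep
  have hD : ∀ i j k, [p, i, j, k].Nodup → D i j k ≠ 0 := fun i j k hn ↦ by
    apply hz <;> grind
  let m : Fin 5 → Fin 5 → F :=
    ![![0, D c d e, -D b d e, D b c e, -D b c d], ![0, 0, D a d e, -D a c e, D a c d],
      ![0, 0, 0, D a b e, -D a b d], ![0, 0, 0, 0, D a b c], ![0, 0, 0, 0, 0]]
  have hm : ∀ i j, i < j → m i j ≠ 0 := by
    simp only [List.nodup_cons, List.mem_cons, List.not_mem_nil, or_false, not_or] at h hD
    intro i j hij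
    fin_cases i <;> fin_cases j <;> first
      | exact absurd hij (by decide)
      | (refine neg_ne_zero.2 (hD _ _ _ ?_); tauto)
      | (refine hD _ _ _ ?_; tauto)
  have key := fiveTerm_brackets
    ![![D d b c, D e b c], ![D a d c, D a e c], ![D a b d, D a b e], ![-D a b c, 0],
      ![0, -D a b c]] m (D a b c) (hD _ _ _ (by clear hD hm; grind)) (fun i j hij ↦ by
        fin_cases i <;> fin_cases j <;> first
          | exact absurd hij (by decide)
          | (simp [dt_two, m, D, det4_expand]; ring)) hm
  have s1 : ∀ i j k, D j i k = -D i j k := fun i j k ↦ det4_swap_mid _ _ _ _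
  have s2 : ∀ i j k, D i k j = -D i j k := fun i j k ↦ det4_swap_last _ _ _ _
  have e0 : crB2 z p a b c d e = b2 F (m 1 3 * m 2 4 / (m 1 4 * m 2 3)) := by
    refine congrArg (b2 F) ?_
    change D a b d * D a c e / (D a b e * D a c d) = -D a c e * -D a b d / (D a c d * D a b e)
    ring
  have e1 : crB2 z p b a c d e = b2 F (m 0 3 * m 2 4 / (m 0 4 * m 2 3)) := by
    refine congrArg (b2 F) ?_
    change D b a d * D b c e / (D b a e * D b c d) = D b c e * -D a b d / (-D b c d * D a b e)
    rw [s1 a b d, s1 a b e]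
    ring
  have e2 : crB2 z p c a b d e = b2 F (m 0 3 * m 1 4 / (m 0 4 * m 1 3)) := by
    refine congrArg (b2 F) ?_
    change D c a d * D c b e / (D c a e * D c b d) = D b c e * D a c d / (-D b c d * -D a c e)
    rw [s1 a c d, s1 a c e, s1 b c d, s1 b c e]
    ring
  have e3 : crB2 z p d a b c e = b2 F (m 0 2 * m 1 4 / (m 0 4 * m 1 2)) := by
    refine congrArg (b2 F) ?_
    change D d a c * D d b e / (D d a e * D d b c) = -D b d e * D a c d / (-D b c d * D a d e)
    rw [s1 a d c, s2 a c d, s1 b d e, s1 a d e, s1 b d c, s2 b c d]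
    ring
  have e4 : crB2 z p e a b c d = b2 F (m 0 2 * m 1 3 / (m 0 3 * m 1 2)) := by
    refine congrArg (b2 F) ?_
    change D e a c * D e b d / (D e a d * D e b c) = -D b d e * -D a c e / (D b c e * D a d e)
    rw [s1 a e c, s2 a c e, s1 b e d, s2 b d e, s1 a e d, s2 a d e, s1 b e c, s2 b c e]
    ring
  rw [e0, e1, e2, e3, e4]
  exact key

lemma fs_mul {x y : F} (hx : x ≠ 0) (hy : y ≠ 0) : fs F (x * y) = fs F x + fs F y := by
  have h : (Submodule.span ℚ (FSrel F)).mkQ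
      (Finsupp.single (x * y) 1 - Finsupp.single x 1 - Finsupp.single y 1) = 0 := by
    rw [Submodule.mkQ_apply, Submodule.Quotient.mk_eq_zero]
    exact Submodule.subset_span (Or.inl ⟨x, y, hx, hy, rfl⟩)
  rw [map_sub, map_sub, sub_sub, sub_eq_zero] at h
  exact h

lemma fs_neg (x : F) : fs F (-x) = fs F x := by
  rcases eq_or_ne x 0 with rfl | hx
  · rw [neg_zero]
  have h1 : fs F (1 : F) = 0 := by simpa using fs_mul (one_ne_zero (α := F)) one_ne_zero
  have hn : (-1 : F) ≠ 0 := neg_ne_zero.2 one_ne_zero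
  have h2 : (2 : ℚ) • fs F (-1 : F) = 0 := by
    rw [two_smul, ← fs_mul hn hn, neg_mul_neg, one_mul, h1]
  have h3 : fs F (-1 : F) = 0 := (smul_eq_zero_iff_right (by norm_num)).1 h2
  rw [neg_eq_neg_one_mul, fs_mul hn hx, h3, zero_add]

lemma wedge_swap {M : Type} [AddCommGroup M] [Module ℚ M] (a b : M) :
    wedge b a = -wedge a b :=
  eq_neg_of_add_eq_zero_left (ExteriorAlgebra.ι_add_mul_swap b a)

/-- `Δ(z_0, z_1, z_2, z_3) ∧ Δ(z_0, z_1, z_2, z_4)`. -/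
def detWedge (z : Fin 8 → Pt F 4) : LamFS F :=
  wedge (fs F (det4 (z 0).rep (z 1).rep (z 2).rep (z 3).rep))
    (fs F (det4 (z 0).rep (z 1).rep (z 2).rep (z 4).rep))

/-- `Alt_8((l_p, l_q | l_a, l_b, l_c, l_d)_2 ⊗ Δ(l_0, l_1, l_2, l_3) ∧ Δ(l_0, l_1, l_2, l_4))`. -/
def altSum (x : Fin 8 → Pt F 4) (p q a b c d : Fin 8) : T22 F :=
  ∑ σ : Equiv.Perm (Fin 8), (Equiv.Perm.sign σ : ℤ) •
    (crB2 (x ∘ σ) p q a b c d ⊗ₜ[ℚ] detWedge (x ∘ σ))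

lemma altSum_comm (x : Fin 8 → Pt F 4) (p q a b c d : Fin 8) :
    altSum x q p a b c d = altSum x p q a b c d := by
  simp only [altSum, crB2_comm _ p q]

lemma altSum_swap (x : Fin 8 → Pt F 4) {i j : Fin 8} (hij : i ≠ j) {ε : ℤ}
    (hε : ∀ z : Fin 8 → Pt F 4, detWedge (z ∘ Equiv.swap i j) = ε • detWedge z)
    (p q a b c d : Fin 8) :
    altSum x p q a b c d = -ε • altSum x (Equiv.swap i j p) (Equiv.swap i j q)
      (Equiv.swap i j a) (Equiv.swap i j b) (Equiv.swap i j c) (Equiv.swap i j d) := by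
  rw [altSum, altSum, ← Equiv.sum_comp (Equiv.mulRight (Equiv.swap i j)), Finset.smul_sum]
  refine Finset.sum_congr rfl fun σ _ ↦ ?_
  have hW : detWedge (x ∘ ⇑(σ * Equiv.swap i j)) = ε • detWedge (x ∘ σ) := hε (x ∘ σ)
  have hA : crB2 (x ∘ ⇑(σ * Equiv.swap i j)) p q a b c d = crB2 (x ∘ σ) (Equiv.swap i j p)
    (Equiv.swap i j q) (Equiv.swap i j a) (Equiv.swap i j b) (Equiv.swap i j c)
    (Equiv.swap i j d) := rfl
  rw [Equiv.coe_mulRight, hW, hA, Equiv.Perm.sign_mul, Equiv.Perm.sign_swap hij,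
    TensorProduct.tmul_smul]
  push_cast
  module

lemma detWedge_swap_of_le_two (z : Fin 8 → Pt F 4) {i j : Fin 8} (hij : i < j) (hj : j ≤ 2) :
    detWedge (z ∘ Equiv.swap i j) = detWedge z := by
  obtain ⟨rfl, rfl⟩ | ⟨rfl, rfl⟩ | ⟨rfl, rfl⟩ :
      (i = 0 ∧ j = 1) ∨ (i = 0 ∧ j = 2) ∨ (i = 1 ∧ j = 2) := by
    revert i j; decide
  · have h : ∀ k, det4 (z 1).rep (z 0).rep (z 2).rep (z k).rep =
        -det4 (z 0).rep (z 1).rep (z 2).rep (z k).rep := fun k ↦ det4_swap_first _ _ _ _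
    change wedge (fs F (det4 (z 1).rep (z 0).rep (z 2).rep (z 3).rep))
      (fs F (det4 (z 1).rep (z 0).rep (z 2).rep (z 4).rep)) = _
    rw [h, h, fs_neg, fs_neg, detWedge]
  · have h : ∀ k, det4 (z 2).rep (z 1).rep (z 0).rep (z k).rep =
        -det4 (z 0).rep (z 1).rep (z 2).rep (z k).rep := fun k ↦ by
      rw [det4_swap_first, det4_swap_mid, det4_swap_first, neg_neg]
    change wedge (fs F (det4 (z 2).rep (z 1).rep (z 0).rep (z 3).rep))
      (fs F (det4 (z 2).rep (z 1).rep (z 0).rep (z 4).rep)) = _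
    rw [h, h, fs_neg, fs_neg, detWedge]
  · have h : ∀ k, det4 (z 0).rep (z 2).rep (z 1).rep (z k).rep =
        -det4 (z 0).rep (z 1).rep (z 2).rep (z k).rep := fun k ↦ det4_swap_mid _ _ _ _
    change wedge (fs F (det4 (z 0).rep (z 2).rep (z 1).rep (z 3).rep))
      (fs F (det4 (z 0).rep (z 2).rep (z 1).rep (z 4).rep)) = _
    rw [h, h, fs_neg, fs_neg, detWedge]

lemma detWedge_swap_of_five_le (z : Fin 8 → Pt F 4) {i j : Fin 8} (hi : 5 ≤ i) (hj : 5 ≤ j) :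
    detWedge (z ∘ Equiv.swap i j) = detWedge z := by
  have h : ∀ k : Fin 8, k < 5 → (z ∘ Equiv.swap i j) k = z k := fun k hk ↦
    congrArg z (Equiv.swap_apply_of_ne_of_ne (hk.trans_le hi).ne (hk.trans_le hj).ne)
  simp only [detWedge, h 0 (by decide), h 1 (by decide), h 2 (by decide), h 3 (by decide),
    h 4 (by decide)]

lemma detWedge_swap_three_four (z : Fin 8 → Pt F 4) :
    detWedge (z ∘ Equiv.swap 3 4) = -detWedge z :=
  wedge_swap _ _

lemma altSum_swap_of_le_two (x : Fin 8 → Pt F 4) {i j : Fin 8} (hij : i < j) (hj : j ≤ 2)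
    (p q a b c d : Fin 8) :
    altSum x p q a b c d = -altSum x (Equiv.swap i j p) (Equiv.swap i j q)
      (Equiv.swap i j a) (Equiv.swap i j b) (Equiv.swap i j c) (Equiv.swap i j d) := by
  simpa using altSum_swap x hij.ne (ε := 1)
    (fun z ↦ by rw [one_smul, detWedge_swap_of_le_two z hij hj]) p q a b c d

lemma altSum_swap_of_five_le (x : Fin 8 → Pt F 4) {i j : Fin 8} (hij : i < j) (hi : 5 ≤ i)
    (p q a b c d : Fin 8) :
    altSum x p q a b c d = -altSum x (Equiv.swap i j p) (Equiv.swap i j q)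
      (Equiv.swap i j a) (Equiv.swap i j b) (Equiv.swap i j c) (Equiv.swap i j d) := by
  simpa using altSum_swap x hij.ne (ε := 1)
    (fun z ↦ by rw [one_smul, detWedge_swap_of_five_le z hi (hi.trans hij.le)]) p q a b c d

lemma altSum_swap_three_four (x : Fin 8 → Pt F 4) (p q a b c d : Fin 8) :
    altSum x p q a b c d = altSum x (Equiv.swap 3 4 p) (Equiv.swap 3 4 q)
      (Equiv.swap 3 4 a) (Equiv.swap 3 4 b) (Equiv.swap 3 4 c) (Equiv.swap 3 4 d) := by
  simpa using altSum_swap x (i := 3) (j := 4) (by decide) (ε := -1)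
    (fun z ↦ by rw [neg_one_smul, detWedge_swap_three_four z]) p q a b c d

lemma Generic8.comp_perm {x : Fin 8 → Pt F 4} (hx : Generic8 x) (σ : Equiv.Perm (Fin 8)) :
    Generic8 (x ∘ σ) := by
  intro a b c d h1 h2 h3 h4 h5 h6
  exact hx _ _ _ _ (σ.injective.ne h1) (σ.injective.ne h2) (σ.injective.ne h3)
    (σ.injective.ne h4) (σ.injective.ne h5) (σ.injective.ne h6)

lemma altSum_swap_first {x : Fin 8 → Pt F 4} (hx : Generic8 x) {p q a b c d : Fin 8}
    (h : [p, q, a, b, c, d].Nodup) :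
    altSum x p q b a c d = -altSum x p q a b c d := by
  simp only [altSum, crB2_swap_first (hx.comp_perm _) h, TensorProduct.neg_tmul, smul_neg,
    Finset.sum_neg_distrib]

lemma altSum_line {x : Fin 8 → Pt F 4} (hx : Generic8 x) {p q a b c d e : Fin 8}
    (h : [p, q, a, b, c, d, e].Nodup) :
    altSum x p q b c d e - altSum x p q a c d e + altSum x p q a b d e - altSum x p q a b c e
      + altSum x p q a b c d = 0 := by
  simp only [altSum, ← Finset.sum_sub_distrib, ← Finset.sum_add_distrib]
  refine Finset.sum_eq_zero fun σ _ ↦ ?_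
  have hσ := congrArg (fun u ↦ u ⊗ₜ[ℚ] detWedge (x ∘ σ)) (crB2_line (hx.comp_perm σ) h)
  simp only [TensorProduct.add_tmul, TensorProduct.sub_tmul, TensorProduct.zero_tmul] at hσ
  linear_combination (norm := module) (Equiv.Perm.sign σ : ℤ) • hσ

lemma altSum_dual {x : Fin 8 → Pt F 4} (hx : Generic8 x) {p a b c d e : Fin 8}
    (h : [p, a, b, c, d, e].Nodup) :
    altSum x p a b c d e - altSum x p b a c d e + altSum x p c a b d e - altSum x p d a b c e
      + altSum x p e a b c d = 0 := by
  simp only [altSum, ← Finset.sum_sub_distrib, ← Finset.sum_add_distrib]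
  refine Finset.sum_eq_zero fun σ _ ↦ ?_
  have hσ := congrArg (fun u ↦ u ⊗ₜ[ℚ] detWedge (x ∘ σ)) (crB2_dual (hx.comp_perm σ) h)
  simp only [TensorProduct.add_tmul, TensorProduct.sub_tmul, TensorProduct.zero_tmul] at hσ
  linear_combination (norm := module) (Equiv.Perm.sign σ : ℤ) • hσ

lemma altSum_three_four {x : Fin 8 → Pt F 4} (hx : Generic8 x) : altSum x 3 4 0 1 5 6 = 0 := by
  have h := altSum_line hx (p := 3) (q := 4) (a := 0) (b := 1) (c := 2) (d := 5) (e := 6)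
    (by decide)
  have h1 : altSum x 3 4 1 2 5 6 = -altSum x 3 4 0 2 5 6 :=
    altSum_swap_of_le_two x (i := 0) (j := 1) (by decide) (by decide) ..
  have h2 : altSum x 3 4 0 2 5 6 = -altSum x 3 4 0 1 5 6 :=
    altSum_swap_of_le_two x (i := 1) (j := 2) (by decide) (by decide) ..
  have h3 : altSum x 3 4 0 1 2 6 = -altSum x 3 4 0 1 2 6 :=
    altSum_swap_of_five_le x (i := 5) (j := 7) (by decide) (by decide) ..
  have h4 : altSum x 3 4 0 1 2 5 = -altSum x 3 4 0 1 2 5 :=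
    altSum_swap_of_five_le x (i := 6) (j := 7) (by decide) (by decide) ..
  linear_combination (norm := module) (1 / 3 : ℚ) • h - (1 / 3 : ℚ) • h1 + (2 / 3 : ℚ) • h2
    + (1 / 6 : ℚ) • h3 - (1 / 6 : ℚ) • h4

lemma altSum_three_five {x : Fin 8 → Pt F 4} (hx : Generic8 x) :
    (3 : ℚ) • altSum x 3 5 0 1 4 6 = altSum x 3 5 0 1 2 6 := by
  have h := altSum_line hx (p := 3) (q := 5) (a := 0) (b := 1) (c := 2) (d := 4) (e := 6)
    (by decide)
  have h1 : altSum x 3 5 1 2 4 6 = -altSum x 3 5 0 2 4 6 :=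
    altSum_swap_of_le_two x (i := 0) (j := 1) (by decide) (by decide) ..
  have h2 : altSum x 3 5 0 2 4 6 = -altSum x 3 5 0 1 4 6 :=
    altSum_swap_of_le_two x (i := 1) (j := 2) (by decide) (by decide) ..
  have h4 : altSum x 3 5 0 1 2 4 = -altSum x 3 5 0 1 2 4 :=
    altSum_swap_of_five_le x (i := 6) (j := 7) (by decide) (by decide) ..
  linear_combination (norm := module) h - h1 + (2 : ℚ) • h2 - (1 / 2 : ℚ) • h4

lemma altSum_dual_three {x : Fin 8 → Pt F 4} (hx : Generic8 x) :
    (3 : ℚ) • altSum x 2 3 0 1 5 6 = (2 : ℚ) • altSum x 3 5 0 1 2 6 := by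
  have h := altSum_dual hx (p := 3) (a := 0) (b := 1) (c := 2) (d := 5) (e := 6) (by decide)
  have h1 : altSum x 3 0 1 2 5 6 = -altSum x 3 1 0 2 5 6 :=
    altSum_swap_of_le_two x (i := 0) (j := 1) (by decide) (by decide) ..
  have h2 : altSum x 3 1 0 2 5 6 = -altSum x 3 2 0 1 5 6 :=
    altSum_swap_of_le_two x (i := 1) (j := 2) (by decide) (by decide) ..
  have h3 : altSum x 3 6 0 1 2 5 = -altSum x 3 5 0 1 2 6 :=
    altSum_swap_of_five_le x (i := 5) (j := 6) (by decide) (by decide) ..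
  rw [altSum_comm x 3 2]
  linear_combination (norm := module) h - h1 + (2 : ℚ) • h2 - h3

lemma altSum_dual_zero {x : Fin 8 → Pt F 4} (hx : Generic8 x) :
    altSum x 2 3 0 1 5 6 = (2 : ℚ) • altSum x 2 5 0 1 4 6 := by
  have h := altSum_dual hx (p := 0) (a := 1) (b := 2) (c := 3) (d := 5) (e := 6) (by decide)
  have h1 : altSum x 0 1 2 3 5 6 = -altSum x 1 0 2 3 5 6 :=
    altSum_swap_of_le_two x (i := 0) (j := 1) (by decide) (by decide) ..
  have h2 : altSum x 0 2 1 3 5 6 = -altSum x 2 0 1 3 5 6 :=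
    altSum_swap_of_le_two x (i := 0) (j := 2) (by decide) (by decide) ..
  have h3 : altSum x 0 6 1 2 3 5 = -altSum x 0 5 1 2 3 6 :=
    altSum_swap_of_five_le x (i := 5) (j := 6) (by decide) (by decide) ..
  have h4 : altSum x 2 3 0 1 5 6 = -altSum x 0 3 2 1 5 6 :=
    altSum_swap_of_le_two x (i := 0) (j := 2) (by decide) (by decide) ..
  have h5 : altSum x 0 3 2 1 5 6 = -altSum x 0 3 1 2 5 6 := altSum_swap_first hx (by decide)
  have h6 : altSum x 2 5 0 1 4 6 = altSum x 2 5 0 1 3 6 := altSum_swap_three_four ..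
  have h7 : altSum x 2 5 0 1 3 6 = -altSum x 0 5 2 1 3 6 :=
    altSum_swap_of_le_two x (i := 0) (j := 2) (by decide) (by decide) ..
  have h8 : altSum x 0 5 2 1 3 6 = -altSum x 0 5 1 2 3 6 := altSum_swap_first hx (by decide)
  rw [altSum_comm x 0 1] at h1
  rw [altSum_comm x 0 2] at h2
  linear_combination (norm := module) h - (1 / 2 : ℚ) • h1 + (1 / 2 : ℚ) • h2 - h3 + h4 - h5
    - (2 : ℚ) • h6 - (2 : ℚ) • h7 + (2 : ℚ) • h8

/-- Lemma 5.7.  For eight points `l_1,...,l_8` in generic position in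
`P³(F)` one has, in `B_2(F) ⊗ Λ²F^*` (indices of the paper are `1`-based):
`Alt_8( (2(l_3,l_4|l_1,l_2,l_6,l_7)_2 + 2(l_3,l_6|l_1,l_2,l_5,l_7)_2 +
2(l_4,l_6|l_1,l_2,l_3,l_7)_2 + 2(l_4,l_6|l_1,l_2,l_5,l_7)_2 + (l_5,l_4|l_1,l_2,l_6,l_7)_2)
⊗ Δ(l_1,l_2,l_3,l_4) ∧ Δ(l_1,l_2,l_3,l_5) )
 = 7·Alt_8( (l_3,l_4|l_1,l_2,l_6,l_7)_2 ⊗ Δ(l_1,l_2,l_3,l_4) ∧ Δ(l_1,l_2,l_3,l_5) )`. -/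
theorem statement17 (F : Type) [Field F] (x : Fin 8 → Pt F 4) (hx : Generic8 x) :
    ∑ σ : Equiv.Perm (Fin 8), (Equiv.Perm.sign σ : ℤ) •
      (((2 : ℚ) • b2 F (crLine (x (σ 2)) (x (σ 3)) (x (σ 0)) (x (σ 1)) (x (σ 5)) (x (σ 6))) +
        (2 : ℚ) • b2 F (crLine (x (σ 2)) (x (σ 5)) (x (σ 0)) (x (σ 1)) (x (σ 4)) (x (σ 6))) +
        (2 : ℚ) • b2 F (crLine (x (σ 3)) (x (σ 5)) (x (σ 0)) (x (σ 1)) (x (σ 2)) (x (σ 6))) +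
        (2 : ℚ) • b2 F (crLine (x (σ 3)) (x (σ 5)) (x (σ 0)) (x (σ 1)) (x (σ 4)) (x (σ 6))) +
        b2 F (crLine (x (σ 4)) (x (σ 3)) (x (σ 0)) (x (σ 1)) (x (σ 5)) (x (σ 6)))) ⊗ₜ[ℚ]
        wedge (fs F (det4 (x (σ 0)).rep (x (σ 1)).rep (x (σ 2)).rep (x (σ 3)).rep))
          (fs F (det4 (x (σ 0)).rep (x (σ 1)).rep (x (σ 2)).rep (x (σ 4)).rep))) =
    (7 : ℚ) • ∑ σ : Equiv.Perm (Fin 8), (Equiv.Perm.sign σ : ℤ) •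
      (b2 F (crLine (x (σ 2)) (x (σ 3)) (x (σ 0)) (x (σ 1)) (x (σ 5)) (x (σ 6))) ⊗ₜ[ℚ]
        wedge (fs F (det4 (x (σ 0)).rep (x (σ 1)).rep (x (σ 2)).rep (x (σ 3)).rep))
          (fs F (det4 (x (σ 0)).rep (x (σ 1)).rep (x (σ 2)).rep (x (σ 4)).rep))) := by
  change ∑ σ : Equiv.Perm (Fin 8), (Equiv.Perm.sign σ : ℤ) •
    (((2 : ℚ) • crB2 (x ∘ σ) 2 3 0 1 5 6 + (2 : ℚ) • crB2 (x ∘ σ) 2 5 0 1 4 6 +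
      (2 : ℚ) • crB2 (x ∘ σ) 3 5 0 1 2 6 + (2 : ℚ) • crB2 (x ∘ σ) 3 5 0 1 4 6 +
      crB2 (x ∘ σ) 4 3 0 1 5 6) ⊗ₜ[ℚ] detWedge (x ∘ σ)) = (7 : ℚ) • altSum x 2 3 0 1 5 6
  have hsum : ∑ σ : Equiv.Perm (Fin 8), (Equiv.Perm.sign σ : ℤ) •
    (((2 : ℚ) • crB2 (x ∘ σ) 2 3 0 1 5 6 + (2 : ℚ) • crB2 (x ∘ σ) 2 5 0 1 4 6 +
      (2 : ℚ) • crB2 (x ∘ σ) 3 5 0 1 2 6 + (2 : ℚ) • crB2 (x ∘ σ) 3 5 0 1 4 6 +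
      crB2 (x ∘ σ) 4 3 0 1 5 6) ⊗ₜ[ℚ] detWedge (x ∘ σ)) =
      (2 : ℚ) • altSum x 2 3 0 1 5 6 + (2 : ℚ) • altSum x 2 5 0 1 4 6 +
      (2 : ℚ) • altSum x 3 5 0 1 2 6 + (2 : ℚ) • altSum x 3 5 0 1 4 6 +
      altSum x 4 3 0 1 5 6 := by
    simp only [altSum, Finset.smul_sum, ← Finset.sum_add_distrib]
    refine Finset.sum_congr rfl fun σ _ ↦ ?_
    simp only [TensorProduct.add_tmul, ← TensorProduct.smul_tmul']
    module
  have h1 := altSum_three_four hx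
  have h2 := altSum_three_five hx
  have h3 := altSum_dual_three hx
  have h4 := altSum_dual_zero hx
  rw [hsum, altSum_comm x 3 4]
  linear_combination (norm := module) h1 + (2 / 3 : ℚ) • h2 - (4 / 3 : ℚ) • h3 - h4

end Gon
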